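/- arXiv:2102.01291 — 3 statements merged into one kernel-verified Lean document; each statement's English description precedes it below -/
import Mathlib

section
/- (Lemma 1, unbiasedness.) Under Assumptions 1 and 2, for every β ∈ ℝ^M, E[θ̂_β] = θ, where θ̂_β := θ̂₀ − X̂′β. -/
open Finset Filter Topology Matrix MeasureTheory ProbabilityTheory
open scoped BigOperators Classical ENNReal NNReal

noncomputable section

namespace Staggered

/-- Treatment dates: `ℕ∞ = ℕ ∪ {∞}`; `⊤` means never treated. -/
abbrev Date : Type := ℕ∞

/-- Period `t : Fin T` stands for calendar period `t + 1`; `periodLT t g` says that period `t`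
is strictly earlier than the treatment date `g` (i.e. `g > t`). -/
def periodLT {T : ℕ} (t : Fin T) (g : Date) : Prop := (((t : ℕ) + 1 : ℕ) : Date) < g

/-- Assumption 1 sample space: the valid assignment vectors, i.e. those in which exactly
`Ng g` units have first-treatment date `g`, for every `g ∈ 𝒢`. -/
def assigns (N : ℕ) (𝒢 : Finset Date) (Ng : Date → ℕ) : Finset (Fin N → 𝒢) :=
  Finset.univ.filter fun d => ∀ g ∈ 𝒢, (Finset.univ.filter fun i => (d i : Date) = g).card = Ng g

/-- Expectation under the uniform distribution on valid assignments (Assumption 1). -/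
def expec (N : ℕ) (𝒢 : Finset Date) (Ng : Date → ℕ) (f : (Fin N → 𝒢) → ℝ) : ℝ :=
  (∑ d ∈ assigns N 𝒢 Ng, f d) / ((assigns N 𝒢 Ng).card : ℝ)

/-- Probability of an event under the uniform distribution on valid assignments. -/
def prob (N : ℕ) (𝒢 : Finset Date) (Ng : Date → ℕ) (p : (Fin N → 𝒢) → Prop) : ℝ :=
  (((assigns N 𝒢 Ng).filter p).card : ℝ) / ((assigns N 𝒢 Ng).card : ℝ)

/-- Variance of a real statistic under the uniform distribution on valid assignments. -/
def varE (N : ℕ) (𝒢 : Finset Date) (Ng : Date → ℕ) (f : (Fin N → 𝒢) → ℝ) : ℝ :=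
  expec N 𝒢 Ng fun d => (f d - expec N 𝒢 Ng f) ^ 2

/-- Covariance of two real statistics under the uniform distribution on valid assignments. -/
def covE (N : ℕ) (𝒢 : Finset Date) (Ng : Date → ℕ) (f h : (Fin N → 𝒢) → ℝ) : ℝ :=
  expec N 𝒢 Ng fun d => (f d - expec N 𝒢 Ng f) * (h d - expec N 𝒢 Ng h)

/-- Observed outcome vectors `Y_i = Y_i(G_i)`. -/
def obs {N T : ℕ} {𝒢 : Finset Date} (Y : Fin N → Date → Fin T → ℝ) (d : Fin N → 𝒢) :
    Fin N → Fin T → ℝ := fun i => Y i (d i)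

/-- Cohort sample mean `Ȳ_g` computed from outcome data `y` and assignment `d`. -/
def cmean {N T : ℕ} {𝒢 : Finset Date} (Ng : Date → ℕ) (y : Fin N → Fin T → ℝ)
    (d : Fin N → 𝒢) (g : Date) : Fin T → ℝ :=
  fun t => (∑ i, if (d i : Date) = g then y i t else 0) / (Ng g : ℝ)

/-- Finite-population mean of a scalar attribute. -/
def popMeanS (N : ℕ) (w : Fin N → ℝ) : ℝ := (∑ i, w i) / (N : ℝ)

/-- Finite-population variance (normalized by `N - 1`) of a scalar attribute. -/
def popVarS (N : ℕ) (w : Fin N → ℝ) : ℝ :=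
  (∑ i, (w i - popMeanS N w) ^ 2) / ((N : ℝ) - 1)

/-- Finite-population mean of a vector attribute. -/
def popMeanV (N K : ℕ) (W : Fin N → Fin K → ℝ) : Fin K → ℝ := fun k => (∑ i, W i k) / (N : ℝ)

/-- Finite-population covariance matrix (normalized by `N - 1`) of a vector attribute. -/
def popCov (N K : ℕ) (W : Fin N → Fin K → ℝ) : Matrix (Fin K) (Fin K) ℝ :=
  Matrix.of fun k l =>
    (∑ i, (W i k - popMeanV N K W k) * (W i l - popMeanV N K W l)) / ((N : ℝ) - 1)

/-- Finite-population cross-covariance matrix of two vector attributes. -/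
def popCrossCov (N K : ℕ) (W V : Fin N → Fin K → ℝ) : Matrix (Fin K) (Fin K) ℝ :=
  Matrix.of fun k l =>
    (∑ i, (W i k - popMeanV N K W k) * (V i l - popMeanV N K V l)) / ((N : ℝ) - 1)

/-- `S_g`: finite-population covariance matrix of the potential outcomes `Y(g)`. -/
def Sg (N T : ℕ) (Y : Fin N → Date → Fin T → ℝ) (g : Date) : Matrix (Fin T) (Fin T) ℝ :=
  popCov N T fun i => Y i g

/-- `S_{gg'}`: finite-population cross-covariance of `Y(g)` and `Y(g')`. -/
def Sgg (N T : ℕ) (Y : Fin N → Date → Fin T → ℝ) (g g' : Date) : Matrix (Fin T) (Fin T) ℝ :=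
  popCrossCov N T (fun i => Y i g) (fun i => Y i g')

/-- Average treatment contrast `τ_{t,gg'}`. -/
def tau (N T : ℕ) (Y : Fin N → Date → Fin T → ℝ) (t : Fin T) (g g' : Date) : ℝ :=
  (∑ i, (Y i g t - Y i g' t)) / (N : ℝ)

/-- Target parameter `θ = Σ_{t,g,g'} a_{t,gg'} τ_{t,gg'}`. -/
def thetaParam (N T : ℕ) (𝒢 : Finset Date) (Y : Fin N → Date → Fin T → ℝ)
    (a : Fin T → Date → Date → ℝ) : ℝ :=
  ∑ t, ∑ g ∈ 𝒢, ∑ g' ∈ 𝒢, a t g g' * tau N T Y t g g'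

/-- Sample analog `θ̂₀` computed from outcome data `y` and assignment `d`. -/
def thetaHat0 {N T : ℕ} (𝒢 : Finset Date) (Ng : Date → ℕ) (a : Fin T → Date → Date → ℝ)
    (y : Fin N → Fin T → ℝ) (d : Fin N → 𝒢) : ℝ :=
  ∑ t, ∑ g ∈ 𝒢, ∑ g' ∈ 𝒢, a t g g' * (cmean Ng y d g t - cmean Ng y d g' t)

/-- The statistic `X̂` computed from outcome data `y` and assignment `d`. -/
def Xhat {N T M : ℕ} (𝒢 : Finset Date) (Ng : Date → ℕ)
    (b : Fin M → Fin T → Date → Date → ℝ) (y : Fin N → Fin T → ℝ) (d : Fin N → 𝒢) :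
    Fin M → ℝ :=
  fun j => ∑ t, ∑ g ∈ 𝒢, ∑ g' ∈ 𝒢, b j t g g' * (cmean Ng y d g t - cmean Ng y d g' t)

/-- Induced row vector `A_{θ,g}` of weights on `Ȳ_g` in `θ̂₀`. -/
def Atheta (T : ℕ) (𝒢 : Finset Date) (a : Fin T → Date → Date → ℝ) (g : Date) :
    Fin T → ℝ := fun t => ∑ g' ∈ 𝒢, (a t g g' - a t g' g)

/-- Induced `M × T` matrix `A_{0,g}` of weights on `Ȳ_g` in `X̂`. -/
def A0 (T M : ℕ) (𝒢 : Finset Date) (b : Fin M → Fin T → Date → Date → ℝ) (g : Date) :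
    Matrix (Fin M) (Fin T) ℝ :=
  Matrix.of fun j t => ∑ g' ∈ 𝒢, (b j t g g' - b j t g' g)

/-- `S_θ`: finite-population variance of the unit-level scalars `Σ_g A_{θ,g} Y_i(g)`. -/
def Stheta (N T : ℕ) (𝒢 : Finset Date) (Y : Fin N → Date → Fin T → ℝ)
    (a : Fin T → Date → Date → ℝ) : ℝ :=
  popVarS N fun i => ∑ g ∈ 𝒢, Atheta T 𝒢 a g ⬝ᵥ Y i g

/-- Within-cohort sample covariance `Ŝ_g` from outcome data `y` and assignment `d`. -/
def Shat {N T : ℕ} {𝒢 : Finset Date} (Ng : Date → ℕ) (y : Fin N → Fin T → ℝ)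
    (d : Fin N → 𝒢) (g : Date) : Matrix (Fin T) (Fin T) ℝ :=
  Matrix.of fun t t' =>
    (∑ i, if (d i : Date) = g then
      (y i t - cmean Ng y d g t) * (y i t' - cmean Ng y d g t') else 0) / ((Ng g : ℝ) - 1)

/-- Plug-in estimate `V̂_{X̂}`. -/
def VhatX {N T M : ℕ} (𝒢 : Finset Date) (Ng : Date → ℕ)
    (b : Fin M → Fin T → Date → Date → ℝ) (y : Fin N → Fin T → ℝ) (d : Fin N → 𝒢) :
    Matrix (Fin M) (Fin M) ℝ :=
  ∑ g ∈ 𝒢, ((Ng g : ℝ))⁻¹ • (A0 T M 𝒢 b g * Shat Ng y d g * (A0 T M 𝒢 b g)ᵀ)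

/-- Plug-in estimate `V̂_{X̂,θ̂₀}`. -/
def VhatXtheta {N T M : ℕ} (𝒢 : Finset Date) (Ng : Date → ℕ)
    (a : Fin T → Date → Date → ℝ) (b : Fin M → Fin T → Date → Date → ℝ)
    (y : Fin N → Fin T → ℝ) (d : Fin N → 𝒢) : Fin M → ℝ :=
  ∑ g ∈ 𝒢, ((Ng g : ℝ))⁻¹ • ((A0 T M 𝒢 b g * Shat Ng y d g).mulVec (Atheta T 𝒢 a g))

/-- Plug-in coefficient `β̂* = V̂_{X̂}⁻¹ V̂_{X̂,θ̂₀}`. -/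
def betaHatStar {N T M : ℕ} (𝒢 : Finset Date) (Ng : Date → ℕ)
    (a : Fin T → Date → Date → ℝ) (b : Fin M → Fin T → Date → Date → ℝ)
    (y : Fin N → Fin T → ℝ) (d : Fin N → 𝒢) : Fin M → ℝ :=
  (VhatX 𝒢 Ng b y d)⁻¹.mulVec (VhatXtheta 𝒢 Ng a b y d)

/-- Plug-in efficient estimator `θ̂_{β̂*} = θ̂₀ - X̂'β̂*`. -/
def thetaHatPlug {N T M : ℕ} (𝒢 : Finset Date) (Ng : Date → ℕ)
    (a : Fin T → Date → Date → ℝ) (b : Fin M → Fin T → Date → Date → ℝ)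
    (y : Fin N → Fin T → ℝ) (d : Fin N → 𝒢) : ℝ :=
  thetaHat0 𝒢 Ng a y d - ∑ j, Xhat 𝒢 Ng b y d j * betaHatStar 𝒢 Ng a b y d j

/-- Neyman-style variance estimator `σ̂*²`. -/
def sigmaSqNeyman {N T M : ℕ} (𝒢 : Finset Date) (Ng : Date → ℕ)
    (a : Fin T → Date → Date → ℝ) (b : Fin M → Fin T → Date → Date → ℝ)
    (y : Fin N → Fin T → ℝ) (d : Fin N → 𝒢) : ℝ :=
  (∑ g ∈ 𝒢, ((N : ℝ) / (Ng g : ℝ)) *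
      (Atheta T 𝒢 a g ⬝ᵥ (Shat Ng y d g).mulVec (Atheta T 𝒢 a g)))
  - (∑ g ∈ 𝒢, ((N : ℝ) / (Ng g : ℝ)) •
        ((A0 T M 𝒢 b g * Shat Ng y d g).mulVec (Atheta T 𝒢 a g))) ⬝ᵥ
    ((∑ g ∈ 𝒢, ((N : ℝ) / (Ng g : ℝ)) •
        (A0 T M 𝒢 b g * Shat Ng y d g * (A0 T M 𝒢 b g)ᵀ))⁻¹.mulVec
      (∑ g ∈ 𝒢, ((N : ℝ) / (Ng g : ℝ)) •
        ((A0 T M 𝒢 b g * Shat Ng y d g).mulVec (Atheta T 𝒢 a g))))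

/-- The `(g_min - 1) × T` selection matrix `M` picking out the periods before `g_min`. -/
def Msel (T gmin : ℕ) : Matrix (Fin (gmin - 1)) (Fin T) ℝ :=
  Matrix.of fun k t => if (t : ℕ) = (k : ℕ) then 1 else 0

/-- `β̂_g = (M Ŝ_g M')⁻¹ M Ŝ_g A_{θ,g}'`. -/
def betaHatg {N T : ℕ} {𝒢 : Finset Date} (Ng : Date → ℕ) (a : Fin T → Date → Date → ℝ)
    (gmin : ℕ) (y : Fin N → Fin T → ℝ) (d : Fin N → 𝒢) (g : Date) : Fin (gmin - 1) → ℝ :=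
  (Msel T gmin * Shat Ng y d g * (Msel T gmin)ᵀ)⁻¹.mulVec
    ((Msel T gmin * Shat Ng y d g).mulVec (Atheta T 𝒢 a g))

/-- Refined variance estimator `σ̂**²`. -/
def sigmaSqRefined {N T M : ℕ} (𝒢 : Finset Date) (Ng : Date → ℕ)
    (a : Fin T → Date → Date → ℝ) (b : Fin M → Fin T → Date → Date → ℝ) (gmin : ℕ)
    (y : Fin N → Fin T → ℝ) (d : Fin N → 𝒢) : ℝ :=
  sigmaSqNeyman 𝒢 Ng a b y d -
    (∑ g ∈ 𝒢.filter fun g => (gmin : Date) ≤ g, betaHatg Ng a gmin y d g) ⬝ᵥ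
      ((Msel T gmin * Shat Ng y d (gmin : Date) * (Msel T gmin)ᵀ).mulVec
        (∑ g ∈ 𝒢.filter fun g => (gmin : Date) ≤ g, betaHatg Ng a gmin y d g))

/-- Studentized plug-in efficient statistic `t = θ̂_{β̂*} / (σ̂** / √N)`. -/
def tstat {N T M : ℕ} (𝒢 : Finset Date) (Ng : Date → ℕ)
    (a : Fin T → Date → Date → ℝ) (b : Fin M → Fin T → Date → Date → ℝ) (gmin : ℕ)
    (y : Fin N → Fin T → ℝ) (d : Fin N → 𝒢) : ℝ :=
  thetaHatPlug 𝒢 Ng a b y d /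
    (Real.sqrt (sigmaSqRefined 𝒢 Ng a b gmin y d) / Real.sqrt (N : ℝ))

/-- Fisher randomization test p-value for the statistic `stat`, based on observed data
`(Y(G), G)` and recomputing the statistic with permuted assignments. -/
def pFRT {N T : ℕ} {𝒢 : Finset Date} (stat : (Fin N → Fin T → ℝ) → (Fin N → 𝒢) → ℝ)
    (Y : Fin N → Date → Fin T → ℝ) (d : Fin N → 𝒢) : ℝ :=
  (((Finset.univ : Finset (Equiv.Perm (Fin N))).filter fun π =>
      stat (obs Y d) (fun i => d (π i)) ≥ stat (obs Y d) d).card : ℝ) /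
    ((Finset.univ : Finset (Equiv.Perm (Fin N))).card : ℝ)

/-- Limit covariance matrix `V*_{X̂}`. -/
def VstarX (T M : ℕ) (𝒢 : Finset Date) (b : Fin M → Fin T → Date → Date → ℝ)
    (p : Date → ℝ) (Sstar : Date → Matrix (Fin T) (Fin T) ℝ) : Matrix (Fin M) (Fin M) ℝ :=
  ∑ g ∈ 𝒢, (p g)⁻¹ • (A0 T M 𝒢 b g * Sstar g * (A0 T M 𝒢 b g)ᵀ)

/-- Limit covariance vector `V*_{X̂,θ̂₀}`. -/
def VstarXtheta (T M : ℕ) (𝒢 : Finset Date) (a : Fin T → Date → Date → ℝ)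
    (b : Fin M → Fin T → Date → Date → ℝ) (p : Date → ℝ)
    (Sstar : Date → Matrix (Fin T) (Fin T) ℝ) : Fin M → ℝ :=
  ∑ g ∈ 𝒢, (p g)⁻¹ • ((A0 T M 𝒢 b g * Sstar g).mulVec (Atheta T 𝒢 a g))

/-- Limit variance `V*_{θ̂₀}`. -/
def VstarTheta (T : ℕ) (𝒢 : Finset Date) (a : Fin T → Date → Date → ℝ) (p : Date → ℝ)
    (Sstar : Date → Matrix (Fin T) (Fin T) ℝ) (Sthetastar : ℝ) : ℝ :=
  (∑ g ∈ 𝒢, (p g)⁻¹ * (Atheta T 𝒢 a g ⬝ᵥ (Sstar g).mulVec (Atheta T 𝒢 a g))) - Sthetastar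

/-- Asymptotic variance `σ*²` of the (plug-in) efficient estimator. -/
def sigmaSqLim (T M : ℕ) (𝒢 : Finset Date) (a : Fin T → Date → Date → ℝ)
    (b : Fin M → Fin T → Date → Date → ℝ) (p : Date → ℝ)
    (Sstar : Date → Matrix (Fin T) (Fin T) ℝ) (Sthetastar : ℝ) : ℝ :=
  VstarTheta T 𝒢 a p Sstar Sthetastar -
    VstarXtheta T M 𝒢 a b p Sstar ⬝ᵥ
      (VstarX T M 𝒢 b p Sstar)⁻¹.mulVec (VstarXtheta T M 𝒢 a b p Sstar)

/-- A bounded real function. -/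
def IsBounded (f : ℝ → ℝ) : Prop := ∃ C, ∀ x, |f x| ≤ C

end Staggered

namespace Staggered

lemma assigns_card_pos (N : ℕ) (𝒢 : Finset Date) (Ng : Date → ℕ)
    (hsum : ∑ g ∈ 𝒢, Ng g = N) : 0 < (assigns N 𝒢 Ng).card := by
  rw [Finset.card_pos]
  have hc : Fintype.card (Fin N) = Fintype.card (Σ g : 𝒢, Fin (Ng g)) := by
    rw [Fintype.card_sigma, Fintype.card_fin, ← hsum]
    simp only [Fintype.card_fin]
    exact (Finset.sum_coe_sort 𝒢 Ng).symm
  let e := Fintype.equivOfCardEq hc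
  refine ⟨fun i => (e i).1, ?_⟩
  simp only [assigns, Finset.mem_filter, Finset.mem_univ, true_and]
  intro g hg
  have h1 : (Finset.univ.filter fun i => ((e i).1 : Date) = g).card
      = Fintype.card (Fin (Ng g)) := by
    rw [← Finset.card_univ]
    symm
    refine Finset.card_bij (fun k _ => e.symm ⟨⟨g, hg⟩, k⟩) ?_ ?_ ?_
    · intro k _
      simp
    · intro k _ l _ h
      have := e.symm.injective h
      simpa using this
    · intro i hi
      simp only [Finset.mem_filter, Finset.mem_univ, true_and] at hi
      rcases hx : e i with ⟨⟨g', hg'⟩, k⟩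
      rw [hx] at hi
      simp only at hi
      subst hi
      exact ⟨k, Finset.mem_univ _, by rw [← hx]; simp⟩
  rw [h1, Fintype.card_fin]

lemma count_swap (N : ℕ) (𝒢 : Finset Date) (Ng : Date → ℕ) (g : Date) (i j : Fin N) :
    (∑ d ∈ assigns N 𝒢 Ng, if (d i : Date) = g then (1 : ℝ) else 0) =
      ∑ d ∈ assigns N 𝒢 Ng, if (d j : Date) = g then (1 : ℝ) else 0 := by
  have hm : ∀ d ∈ assigns N 𝒢 Ng, (fun k => d (Equiv.swap i j k)) ∈ assigns N 𝒢 Ng := by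
    intro d hd
    simp only [assigns, Finset.mem_filter, Finset.mem_univ, true_and] at hd ⊢
    intro g hg
    rw [← hd g hg]
    refine Finset.card_bij (fun k _ => Equiv.swap i j k) ?_ ?_ ?_
    · intro k hk
      simpa using hk
    · intro k _ l _ h
      exact (Equiv.swap i j).injective h
    · intro k hk
      exact ⟨Equiv.swap i j k, by simpa using hk, by simp⟩
  refine Finset.sum_bij' (fun d _ k => d (Equiv.swap i j k)) (fun d _ k => d (Equiv.swap i j k))
    hm hm ?_ ?_ ?_
  · intro d _; funext k; simp
  · intro d _; funext k; simp
  · intro d _; simp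

lemma count_eq (N : ℕ) (𝒢 : Finset Date) (Ng : Date → ℕ) (g : Date) (hg : g ∈ 𝒢) (i : Fin N) :
    (N : ℝ) * (∑ d ∈ assigns N 𝒢 Ng, if (d i : Date) = g then (1 : ℝ) else 0) =
      ((assigns N 𝒢 Ng).card : ℝ) * (Ng g : ℝ) := by
  have h1 : (N : ℝ) * (∑ d ∈ assigns N 𝒢 Ng, if (d i : Date) = g then (1 : ℝ) else 0) =
      ∑ j : Fin N, ∑ d ∈ assigns N 𝒢 Ng, if (d j : Date) = g then (1 : ℝ) else 0 := by
    rw [Finset.sum_congr rfl (fun j _ => count_swap N 𝒢 Ng g j i)]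
    simp
  rw [h1, Finset.sum_comm]
  rw [← nsmul_eq_mul]
  apply Finset.sum_eq_card_nsmul
  intro d hd
  simp only [assigns, Finset.mem_filter, Finset.mem_univ, true_and] at hd
  rw [← hd g hg, Finset.sum_boole]

lemma expec_cmean (N T : ℕ) (𝒢 : Finset Date) (Ng : Date → ℕ) (Y : Fin N → Date → Fin T → ℝ)
    (hN : 2 ≤ N) (hNg : ∀ g ∈ 𝒢, 1 ≤ Ng g) (hsum : ∑ g ∈ 𝒢, Ng g = N)
    (g : Date) (hg : g ∈ 𝒢) (t : Fin T) :
    expec N 𝒢 Ng (fun d => cmean Ng (obs Y d) d g t) = (∑ i, Y i g t) / (N : ℝ) := by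
  have hc : ((assigns N 𝒢 Ng).card : ℝ) ≠ 0 := by
    exact_mod_cast (assigns_card_pos N 𝒢 Ng hsum).ne'
  have hn : (Ng g : ℝ) ≠ 0 := by
    have := hNg g hg
    exact_mod_cast (by omega : Ng g ≠ 0)
  have hN0 : (N : ℝ) ≠ 0 := by exact_mod_cast (by omega : N ≠ 0)
  have h1 : ∀ d : Fin N → 𝒢, cmean Ng (obs Y d) d g t =
      (∑ i, Y i g t * if (d i : Date) = g then (1 : ℝ) else 0) / (Ng g : ℝ) := by
    intro d
    unfold cmean obs
    congr 1
    refine Finset.sum_congr rfl fun i _ => ?_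
    by_cases h : (d i : Date) = g
    · simp [h]
    · simp [h]
  unfold expec
  simp only [h1]
  rw [← Finset.sum_div, Finset.sum_comm]
  simp only [← Finset.mul_sum]
  have h2 : ∀ i : Fin N, (∑ d ∈ assigns N 𝒢 Ng, if (d i : Date) = g then (1 : ℝ) else 0) =
      ((assigns N 𝒢 Ng).card : ℝ) * (Ng g : ℝ) / N := by
    intro i
    rw [eq_div_iff hN0, mul_comm, count_eq N 𝒢 Ng g hg i]
  simp only [h2]
  rw [← Finset.sum_mul]
  field_simp

lemma expec_sub (N : ℕ) (𝒢 : Finset Date) (Ng : Date → ℕ) (f h : (Fin N → 𝒢) → ℝ) :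
    expec N 𝒢 Ng (fun d => f d - h d) = expec N 𝒢 Ng f - expec N 𝒢 Ng h := by
  simp only [expec, Finset.sum_sub_distrib, sub_div]

lemma expec_const_mul (N : ℕ) (𝒢 : Finset Date) (Ng : Date → ℕ) (c : ℝ) (f : (Fin N → 𝒢) → ℝ) :
    expec N 𝒢 Ng (fun d => c * f d) = c * expec N 𝒢 Ng f := by
  simp only [expec, ← Finset.mul_sum, mul_div_assoc]

lemma expec_sum {ι : Type*} (N : ℕ) (𝒢 : Finset Date) (Ng : Date → ℕ) (s : Finset ι)
    (f : ι → (Fin N → 𝒢) → ℝ) :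
    expec N 𝒢 Ng (fun d => ∑ k ∈ s, f k d) = ∑ k ∈ s, expec N 𝒢 Ng (f k) := by
  simp only [expec]
  rw [Finset.sum_comm, Finset.sum_div]

lemma expec_contrast (N T : ℕ) (𝒢 : Finset Date) (Ng : Date → ℕ) (Y : Fin N → Date → Fin T → ℝ)
    (a : Fin T → Date → Date → ℝ)
    (hN : 2 ≤ N) (hNg : ∀ g ∈ 𝒢, 1 ≤ Ng g) (hsum : ∑ g ∈ 𝒢, Ng g = N) :
    expec N 𝒢 Ng (fun d => thetaHat0 𝒢 Ng a (obs Y d) d) = thetaParam N T 𝒢 Y a := by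
  unfold thetaHat0 thetaParam
  rw [expec_sum]
  refine Finset.sum_congr rfl fun t _ => ?_
  rw [expec_sum]
  refine Finset.sum_congr rfl fun g hg => ?_
  rw [expec_sum]
  refine Finset.sum_congr rfl fun g' hg' => ?_
  rw [expec_const_mul, expec_sub, expec_cmean N T 𝒢 Ng Y hN hNg hsum g hg t,
    expec_cmean N T 𝒢 Ng Y hN hNg hsum g' hg' t, tau, Finset.sum_sub_distrib, sub_div]

/-- **Lemma 1, unbiasedness.** Under Assumptions 1 and 2, for every `β ∈ ℝ^M`,
`E[θ̂_β] = θ`, where `θ̂_β = θ̂₀ - X̂'β`. -/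
theorem statement3
    (N T M : ℕ) (𝒢 : Finset Date) (Ng : Date → ℕ) (Y : Fin N → Date → Fin T → ℝ)
    (a : Fin T → Date → Date → ℝ) (b : Fin M → Fin T → Date → Date → ℝ)
    (hN : 2 ≤ N) (h𝒢ne : 𝒢.Nonempty)
    (h𝒢 : ∀ g ∈ 𝒢, (1 ≤ g ∧ g ≤ (T : Date)) ∨ g = ⊤)
    (hNg : ∀ g ∈ 𝒢, 1 ≤ Ng g) (hsum : ∑ g ∈ 𝒢, Ng g = N)
    (hNA : ∀ (i : Fin N) (t : Fin T), ∀ g ∈ 𝒢, ∀ g' ∈ 𝒢,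
      periodLT t g → periodLT t g' → Y i g t = Y i g' t)
    (hb : ∀ (j : Fin M) (t : Fin T) (g g' : Date),
      b j t g g' ≠ 0 → periodLT t g ∧ periodLT t g') :
    ∀ β : Fin M → ℝ,
      expec N 𝒢 Ng (fun d =>
          thetaHat0 𝒢 Ng a (obs Y d) d - ∑ j, Xhat 𝒢 Ng b (obs Y d) d j * β j) =
        thetaParam N T 𝒢 Y a := by
  intro β
  rw [expec_sub, expec_contrast N T 𝒢 Ng Y a hN hNg hsum, expec_sum]
  have hX : ∀ j : Fin M, expec N 𝒢 Ng (fun d => Xhat 𝒢 Ng b (obs Y d) d j * β j) = 0 := by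
    intro j
    have h1 : expec N 𝒢 Ng (fun d => Xhat 𝒢 Ng b (obs Y d) d j) = thetaParam N T 𝒢 Y (b j) :=
      expec_contrast N T 𝒢 Ng Y (b j) hN hNg hsum
    have h2 : thetaParam N T 𝒢 Y (b j) = 0 := by
      unfold thetaParam
      refine Finset.sum_eq_zero fun t _ => Finset.sum_eq_zero fun g hg =>
        Finset.sum_eq_zero fun g' hg' => ?_
      by_cases h : b j t g g' = 0
      · rw [h, zero_mul]
      · obtain ⟨p, p'⟩ := hb j t g g' h
        have h3 : tau N T Y t g g' = 0 := by
          unfold tau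
          rw [Finset.sum_eq_zero, zero_div]
          intro i _
          rw [hNA i t g hg g' hg' p p', sub_self]
        rw [h3, mul_zero]
    simp only [mul_comm _ (β j)]
    rw [expec_const_mul, h1, h2, mul_zero]
  simp [hX]

end Staggered
end
end

section
/- (Proposition 1, explicit variance formulas.) Under Assumptions 1 and 2: Var(θ̂₀) = Σ_{g∈𝒢} N_g^{-1} A_{θ,g} S_g A_{θ,g}′ − N^{-1} S_θ, Cov(X̂, θ̂₀) = Σ_{g∈𝒢} N_g^{-1} A_{0,g} S_g A_{θ,g}′, and Var(X̂) = Σ_{g∈𝒢} N_g^{-1} A_{0,g} S_g A_{0,g}′, where S_θ := S(Σ_{g∈𝒢} A_{θ,g} Y(g)) is the finite-population variance of the unit-level scalars Σ_{g∈𝒢} A_{θ,g} Y_i(g). -/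
open Finset Filter Topology Matrix MeasureTheory ProbabilityTheory
open scoped BigOperators Classical ENNReal NNReal

noncomputable section

namespace Staggered

/-- indicator -/
def ind {N : ℕ} {K : Type} (d : Fin N → K) (i : Fin N) (g : K) : ℝ := if d i = g then 1 else 0

lemma exists_perm2 {N : ℕ} (i j i' j' : Fin N) (h : i ≠ j) (h' : i' ≠ j') :
    ∃ σ : Equiv.Perm (Fin N), σ i = i' ∧ σ j = j' := by
  refine ⟨Equiv.swap (Equiv.swap i i' j) j' * Equiv.swap i i', ?_, ?_⟩
  · rw [Equiv.Perm.mul_apply, Equiv.swap_apply_left, Equiv.swap_apply_of_ne_of_ne _ h']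
    intro hh
    have : Equiv.swap i i' i = Equiv.swap i i' j := by rw [Equiv.swap_apply_left]; exact hh
    exact h ((Equiv.swap i i').injective this)
  · rw [Equiv.Perm.mul_apply, Equiv.swap_apply_left]

section
variable {N : ℕ} {K : Type} [Fintype K] (Ω : Finset (Fin N → K)) (n : K → ℝ)

lemma sum_perm (hΩ : ∀ d ∈ Ω, ∀ σ : Equiv.Perm (Fin N), d ∘ σ ∈ Ω)
    (σ : Equiv.Perm (Fin N)) (f : (Fin N → K) → ℝ) :
    ∑ d ∈ Ω, f (d ∘ σ) = ∑ d ∈ Ω, f d := by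
  refine Finset.sum_bij' (fun d _ => d ∘ σ) (fun d _ => d ∘ σ.symm)
    (fun d hd => hΩ d hd σ) (fun d hd => hΩ d hd σ.symm) ?_ ?_ (fun _ _ => rfl)
  · intro d _; ext; simp
  · intro d _; ext; simp

lemma first_moment (hN : 2 ≤ N) (hΩ : ∀ d ∈ Ω, ∀ σ : Equiv.Perm (Fin N), d ∘ σ ∈ Ω)
    (hn : ∀ d ∈ Ω, ∀ g, ∑ i, ind d i g = n g) (i : Fin N) (g : K) :
    ∑ d ∈ Ω, ind d i g = Ω.card * (n g / N) := by
  have h1 : ∀ j, ∑ d ∈ Ω, ind d j g = ∑ d ∈ Ω, ind d i g := by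
    intro j
    rw [← sum_perm Ω hΩ (Equiv.swap i j) (fun d => ind d j g)]
    simp [ind]
  have h2 : ∑ j, ∑ d ∈ Ω, ind d j g = Ω.card * n g := by
    rw [Finset.sum_comm, Finset.sum_congr rfl (fun d hd => hn d hd g)]
    simp
  rw [Finset.sum_congr rfl (fun j _ => h1 j)] at h2
  simp only [Finset.sum_const, Finset.card_univ, Fintype.card_fin, nsmul_eq_mul] at h2
  have : (N : ℝ) ≠ 0 := by positivity
  field_simp
  linarith

lemma second_moment (hN : 2 ≤ N) (hΩ : ∀ d ∈ Ω, ∀ σ : Equiv.Perm (Fin N), d ∘ σ ∈ Ω)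
    (hn : ∀ d ∈ Ω, ∀ g, ∑ i, ind d i g = n g) (i j : Fin N) (hij : i ≠ j) (g g' : K) :
    ∑ d ∈ Ω, ind d i g * ind d j g' =
      Ω.card * ((n g * n g' - if g = g' then n g else 0) / (N * (N - 1))) := by
  have h1 : ∀ k l, (∑ d ∈ Ω, if k = l then 0 else ind d k g * ind d l g') =
      if k = l then 0 else ∑ d ∈ Ω, ind d i g * ind d j g' := by
    intro k l
    by_cases hkl : k = l
    · simp [hkl]
    obtain ⟨σ, rfl, rfl⟩ := exists_perm2 i j k l hij hkl
    rw [← sum_perm Ω hΩ σ (fun d => ind d i g * ind d j g')]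
    simp [hkl, ind]
  have h2 : ∑ k, ∑ l, (∑ d ∈ Ω, if k = l then 0 else ind d k g * ind d l g') =
      Ω.card * (n g * n g' - if g = g' then n g else 0) := by
    have : ∀ d ∈ Ω, ∑ k, ∑ l, (if k = l then 0 else ind d k g * ind d l g') =
        n g * n g' - if g = g' then n g else 0 := by
      intro d hd
      have e : ∀ k l, (if k = l then 0 else ind d k g * ind d l g') =
          ind d k g * ind d l g' - if k = l then ind d k g * ind d l g' else 0 := by
        intro k l; split_ifs <;> simp
      simp only [e, Finset.sum_sub_distrib, ← Finset.mul_sum, hn d hd, Finset.sum_ite_eq,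
        Finset.mem_univ, if_true, ← Finset.sum_mul]
      congr 1
      by_cases hg : g = g'
      · subst hg
        rw [if_pos rfl, ← hn d hd g]
        exact Finset.sum_congr rfl fun k _ => by simp [ind]
      · rw [if_neg hg]
        refine Finset.sum_eq_zero fun k _ => ?_
        simp only [ind]
        split_ifs with h3 h4 <;> simp
        exact hg (h3.symm.trans h4)
    calc _ = ∑ d ∈ Ω, ∑ k, ∑ l, (if k = l then 0 else ind d k g * ind d l g') := by
          rw [Finset.sum_comm (s := Ω)]
          refine Finset.sum_congr rfl fun k _ => ?_
          rw [Finset.sum_comm]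
      _ = _ := by rw [Finset.sum_congr rfl this, Finset.sum_const, nsmul_eq_mul]
  simp only [h1] at h2
  set p := ∑ d ∈ Ω, ind d i g * ind d j g' with hp
  have h3 : ∑ k : Fin N, ∑ l : Fin N, (if k = l then 0 else p) = N * (N - 1) * p := by
    have e : ∀ k l : Fin N, (if k = l then 0 else p) = p - if k = l then p else 0 := by
      intro k l; split_ifs <;> simp
    simp only [e, Finset.sum_sub_distrib, Finset.sum_ite_eq, Finset.mem_univ, if_true]
    simp
    ring
  rw [h3] at h2
  have a1 : (2 : ℝ) ≤ N := by exact_mod_cast hN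
  have a2 : (N : ℝ) ≠ 0 := by positivity
  have a3 : (N : ℝ) - 1 ≠ 0 := by linarith
  rw [← mul_div_assoc, eq_div_iff (mul_ne_zero a2 a3), ← h2]
  ring

/-- linear statistic -/
def lin (u : Fin N → K → ℝ) (d : Fin N → K) : ℝ := ∑ i, ∑ g, ind d i g * (u i g / n g)

lemma lin_first (hN : 2 ≤ N) (hΩ : ∀ d ∈ Ω, ∀ σ : Equiv.Perm (Fin N), d ∘ σ ∈ Ω)
    (hn : ∀ d ∈ Ω, ∀ g, ∑ i, ind d i g = n g) (hn0 : ∀ g, n g ≠ 0) (u : Fin N → K → ℝ) :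
    ∑ d ∈ Ω, lin n u d = Ω.card * ∑ g, (∑ i, u i g) / N := by
  have a1 : (2 : ℝ) ≤ N := by exact_mod_cast hN
  have a2 : (N : ℝ) ≠ 0 := by positivity
  unfold lin
  rw [Finset.sum_comm]
  calc _ = ∑ i, ∑ g, (∑ d ∈ Ω, ind d i g) * (u i g / n g) := by
        refine Finset.sum_congr rfl fun i _ => ?_
        rw [Finset.sum_comm]
        simp only [Finset.sum_mul]
    _ = ∑ i, ∑ g, Ω.card * (u i g / N) := by
        refine Finset.sum_congr rfl fun i _ => Finset.sum_congr rfl fun g _ => ?_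
        rw [first_moment Ω n hN hΩ hn]
        have := hn0 g
        field_simp
    _ = _ := by
        rw [Finset.sum_comm]
        simp only [Finset.mul_sum, Finset.sum_div]

lemma lin_second (hN : 2 ≤ N) (hΩ : ∀ d ∈ Ω, ∀ σ : Equiv.Perm (Fin N), d ∘ σ ∈ Ω)
    (hn : ∀ d ∈ Ω, ∀ g, ∑ i, ind d i g = n g) (hn0 : ∀ g, n g ≠ 0) (u v : Fin N → K → ℝ)
    (hu : ∀ g, ∑ i, u i g = 0) :
    ∑ d ∈ Ω, lin n u d * lin n v d = Ω.card *
      (∑ g, (n g)⁻¹ * ((∑ i, u i g * v i g) / (N - 1)) -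
        (N : ℝ)⁻¹ * ((∑ i, (∑ g, u i g) * (∑ g, v i g)) / (N - 1))) := by
  have a1 : (2 : ℝ) ≤ N := by exact_mod_cast hN
  have a2 : (N : ℝ) ≠ 0 := by positivity
  have a3 : (N : ℝ) - 1 ≠ 0 := by linarith
  have key : ∀ g g', ∑ i, ∑ j, (∑ d ∈ Ω, ind d i g * ind d j g') * (u i g * v j g') =
      Ω.card * (((if g = g' then n g * (N : ℝ) else 0) - n g * n g') / (N * (N - 1)) *
        ∑ i, u i g * v i g') := by
    intro g g'
    set q := (n g * n g' - if g = g' then n g else 0) / ((N : ℝ) * (N - 1)) with hq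
    have e : ∀ i j, ∑ d ∈ Ω, ind d i g * ind d j g' =
        Ω.card * (q + if i = j then ((if g = g' then n g / N else 0) - q) else 0) := by
      intro i j
      by_cases hij : i = j
      · subst hij
        simp only [if_true]
        by_cases hg : g = g'
        · subst hg
          rw [if_pos rfl, add_sub_cancel, ← first_moment Ω n hN hΩ hn i g]
          exact Finset.sum_congr rfl fun k _ => by simp [ind]
        · rw [if_neg hg]
          simp only [zero_sub, add_neg_cancel, mul_zero]
          refine Finset.sum_eq_zero fun k _ => ?_
          simp only [ind]
          split_ifs with h3 h4 <;> simp
          exact hg (h3.symm.trans h4)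
      · rw [second_moment Ω n hN hΩ hn i j hij]
        simp [hij, hq]
    simp only [e, mul_assoc, ← Finset.mul_sum, add_mul, Finset.sum_add_distrib, ite_mul, zero_mul,
      Finset.sum_ite_eq, Finset.mem_univ, if_true, ← Finset.sum_mul, hu, mul_zero, zero_add]
    congr 2
    rw [hq]
    split_ifs <;> field_simp <;> ring
  calc _ = ∑ d ∈ Ω, ∑ g, ∑ g', ∑ i, ∑ j, (ind d i g * ind d j g') * (u i g * v j g') * ((n g)⁻¹ * (n g')⁻¹) := by
        refine Finset.sum_congr rfl fun d _ => ?_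
        unfold lin
        rw [Finset.sum_comm, Finset.sum_comm (f := fun i g => ind d i g * (v i g / n g)),
          Finset.sum_mul_sum]
        refine Finset.sum_congr rfl fun g _ => Finset.sum_congr rfl fun g' _ => ?_
        rw [Finset.sum_mul_sum]
        refine Finset.sum_congr rfl fun i _ => Finset.sum_congr rfl fun j _ => ?_
        ring
    _ = ∑ g, ∑ g', (∑ i, ∑ j, (∑ d ∈ Ω, ind d i g * ind d j g') * (u i g * v j g')) *
          ((n g)⁻¹ * (n g')⁻¹) := by
        rw [Finset.sum_comm]
        refine Finset.sum_congr rfl fun g _ => ?_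
        rw [Finset.sum_comm]
        refine Finset.sum_congr rfl fun g' _ => ?_
        rw [Finset.sum_comm, Finset.sum_mul]
        refine Finset.sum_congr rfl fun i _ => ?_
        rw [Finset.sum_comm, Finset.sum_mul]
        refine Finset.sum_congr rfl fun j _ => ?_
        rw [Finset.sum_mul, Finset.sum_mul]
    _ = ∑ g, ∑ g', Ω.card * ((if g = g' then (n g)⁻¹ * ((∑ i, u i g * v i g') / (N - 1)) else 0) -
          (N : ℝ)⁻¹ * ((∑ i, u i g * v i g') / (N - 1))) := by
        refine Finset.sum_congr rfl fun g _ => Finset.sum_congr rfl fun g' _ => ?_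
        rw [key]
        have h1 := hn0 g
        have h2 := hn0 g'
        split_ifs with h
        · subst h; field_simp
        · field_simp; ring
    _ = _ := by
        simp only [← Finset.mul_sum, Finset.sum_sub_distrib, Finset.sum_ite_eq, Finset.mem_univ,
          if_true, ← Finset.sum_div]
        congr 4
        simp_rw [Finset.sum_mul_sum]
        rw [Finset.sum_comm' (t' := Finset.univ) (s' := fun _ => Finset.univ) (by simp)]
        conv_rhs => rw [Finset.sum_comm]
        rw [Finset.sum_comm]
        refine Finset.sum_congr rfl fun i _ => ?_
        rw [Finset.sum_comm]

/-- scalar finite-population covariance -/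
def pc (x y : Fin N → ℝ) : ℝ :=
  (∑ i, (x i - popMeanS N x) * (y i - popMeanS N y)) / ((N : ℝ) - 1)

lemma lin_shift (d : Fin N → K) (hn0 : ∀ g, n g ≠ 0)
    (hn : ∀ g, ∑ i, ind d i g = n g) (u : Fin N → K → ℝ) (c : K → ℝ) :
    lin n (fun i g => u i g - c g) d = lin n u d - ∑ g, c g := by
  unfold lin
  have : ∑ g, c g = ∑ i, ∑ g, ind d i g * (c g / n g) := by
    rw [Finset.sum_comm]
    refine Finset.sum_congr rfl fun g _ => ?_
    rw [← Finset.sum_mul, hn]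
    have := hn0 g
    field_simp
  rw [this, ← Finset.sum_sub_distrib]
  refine Finset.sum_congr rfl fun i _ => ?_
  rw [← Finset.sum_sub_distrib]
  refine Finset.sum_congr rfl fun g _ => ?_
  ring

lemma lin_cov (hN : 2 ≤ N) (hΩ : ∀ d ∈ Ω, ∀ σ : Equiv.Perm (Fin N), d ∘ σ ∈ Ω)
    (hΩ0 : Ω.Nonempty)
    (hn : ∀ d ∈ Ω, ∀ g, ∑ i, ind d i g = n g) (hn0 : ∀ g, n g ≠ 0) (u v : Fin N → K → ℝ) :
    (∑ d ∈ Ω, (lin n u d - (∑ d ∈ Ω, lin n u d) / Ω.card) *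
      (lin n v d - (∑ d ∈ Ω, lin n v d) / Ω.card)) / Ω.card =
      ∑ g, (n g)⁻¹ * pc (fun i => u i g) (fun i => v i g) -
        (N : ℝ)⁻¹ * pc (fun i => ∑ g, u i g) (fun i => ∑ g, v i g) := by
  have hc : (Ω.card : ℝ) ≠ 0 := by exact_mod_cast hΩ0.card_pos.ne'
  have a2 : (N : ℝ) ≠ 0 := by positivity
  have e : ∀ w : Fin N → K → ℝ, ∀ d ∈ Ω, lin n w d - (∑ d ∈ Ω, lin n w d) / Ω.card =
      lin n (fun i g => w i g - popMeanS N (fun i => w i g)) d := by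
    intro w d hd
    rw [lin_shift n d hn0 (hn d hd), lin_first Ω n hN hΩ hn hn0, mul_div_cancel_left₀ _ hc]
    rfl
  rw [Finset.sum_congr rfl (fun d hd => by rw [e u d hd, e v d hd]),
    lin_second Ω n hN hΩ hn hn0, mul_div_cancel_left₀ _ hc]
  · have m : ∀ w : Fin N → K → ℝ, popMeanS N (fun i => ∑ g, w i g) =
        ∑ g, popMeanS N (fun i => w i g) := by
      intro w
      unfold popMeanS
      rw [Finset.sum_comm, Finset.sum_div]
    simp only [pc, m, Finset.sum_sub_distrib]
  · intro g
    simp only [Finset.sum_sub_distrib, popMeanS]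
    simp
    field_simp
    simp

end

end Staggered

namespace Staggered

lemma pc_dot {N T : ℕ} (A B : Fin T → ℝ) (W : Fin N → Fin T → ℝ) :
    pc (fun i => A ⬝ᵥ W i) (fun i => B ⬝ᵥ W i) = A ⬝ᵥ (popCov N T W).mulVec B := by
  have m : ∀ (A : Fin T → ℝ) i, A ⬝ᵥ W i - popMeanS N (fun i => A ⬝ᵥ W i) =
      ∑ t, A t * (W i t - popMeanV N T W t) := by
    intro A i
    simp only [popMeanS, popMeanV, dotProduct, mul_sub, Finset.sum_sub_distrib]
    rw [Finset.sum_comm, Finset.sum_div]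
    simp only [← Finset.mul_sum, mul_div_assoc]
  unfold pc
  simp only [m, Finset.sum_mul_sum]
  simp only [dotProduct, mulVec, popCov, Matrix.of_apply, Finset.mul_sum]
  rw [Finset.sum_comm, Finset.sum_div]
  refine Finset.sum_congr rfl fun t _ => ?_
  rw [Finset.sum_comm, Finset.sum_div]
  refine Finset.sum_congr rfl fun s _ => ?_
  rw [div_mul_eq_mul_div, ← mul_div_assoc, Finset.sum_mul, Finset.mul_sum]
  congr 1
  refine Finset.sum_congr rfl fun i _ => ?_
  ring

lemma contrast_eq {T : ℕ} (𝒢 : Finset Date) (a : Fin T → Date → Date → ℝ)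
    (m : Date → Fin T → ℝ) :
    ∑ t, ∑ g ∈ 𝒢, ∑ g' ∈ 𝒢, a t g g' * (m g t - m g' t) =
      ∑ g ∈ 𝒢, Atheta T 𝒢 a g ⬝ᵥ m g := by
  simp only [dotProduct, Atheta]
  rw [Finset.sum_comm (s := 𝒢)]
  refine Finset.sum_congr rfl fun t _ => ?_
  simp only [mul_sub, Finset.sum_sub_distrib, sub_mul, Finset.sum_mul]
  congr 1
  rw [Finset.sum_comm]

lemma thetaHat0_eq_lin {N T : ℕ} (𝒢 : Finset Date) (Ng : Date → ℕ)
    (Y : Fin N → Date → Fin T → ℝ) (a : Fin T → Date → Date → ℝ) (d : Fin N → 𝒢) :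
    thetaHat0 𝒢 Ng a (obs Y d) d =
      lin (fun g : 𝒢 => (Ng g : ℝ)) (fun i g => Atheta T 𝒢 a g ⬝ᵥ Y i g) d := by
  unfold thetaHat0 lin
  rw [contrast_eq 𝒢 a (fun g t => cmean Ng (obs Y d) d g t), Finset.sum_comm,
    ← Finset.sum_coe_sort 𝒢]
  refine Finset.sum_congr rfl fun g _ => ?_
  simp only [dotProduct, cmean, obs, ind]
  simp only [Finset.sum_div, Finset.mul_sum]
  rw [Finset.sum_comm]
  refine Finset.sum_congr rfl fun i _ => ?_
  refine Finset.sum_congr rfl fun t _ => ?_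
  by_cases h : d i = g
  · subst h; simp; ring
  · have h' : ¬ ((d i : Date) = g) := fun hh => h (Subtype.ext hh)
    simp [h, h']

lemma assigns_nonempty (N : ℕ) (𝒢 : Finset Date) (Ng : Date → ℕ)
    (hsum : ∑ g ∈ 𝒢, Ng g = N) : (assigns N 𝒢 Ng).Nonempty := by
  have hc : Fintype.card (Fin N) = Fintype.card (Σ g : 𝒢, Fin (Ng g)) := by
    rw [Fintype.card_sigma]
    simp only [Fintype.card_fin]
    rw [Finset.sum_coe_sort 𝒢 Ng, hsum]
  let e := Fintype.equivOfCardEq hc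
  refine ⟨fun i => (e i).1, ?_⟩
  simp only [assigns, Finset.mem_filter, Finset.mem_univ, true_and]
  intro g hg
  have h2 : Fintype.card {i : Fin N // ((e i).1 : Date) = g} = Fintype.card (Fin (Ng g)) := by
    refine Fintype.card_congr ((e.subtypeEquiv (q := fun x => x.1 = ⟨g, hg⟩) ?_).trans
      (Equiv.sigmaSubtype (β := fun g : 𝒢 => Fin (Ng g)) ⟨g, hg⟩))
    intro i
    rw [Subtype.ext_iff]
  rw [Fintype.card_fin] at h2
  rw [← h2, Fintype.card_subtype]

lemma cov_theta {N T : ℕ} (𝒢 : Finset Date) (Ng : Date → ℕ)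
    (Y : Fin N → Date → Fin T → ℝ) (a a' : Fin T → Date → Date → ℝ)
    (hN : 2 ≤ N) (hNg : ∀ g ∈ 𝒢, 1 ≤ Ng g) (hsum : ∑ g ∈ 𝒢, Ng g = N) :
    covE N 𝒢 Ng (fun d => thetaHat0 𝒢 Ng a (obs Y d) d)
        (fun d => thetaHat0 𝒢 Ng a' (obs Y d) d) =
      (∑ g ∈ 𝒢, ((Ng g : ℝ))⁻¹ *
        (Atheta T 𝒢 a g ⬝ᵥ (Sg N T Y g).mulVec (Atheta T 𝒢 a' g))) -
        ((N : ℝ))⁻¹ * pc (fun i => ∑ g ∈ 𝒢, Atheta T 𝒢 a g ⬝ᵥ Y i g)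
          (fun i => ∑ g ∈ 𝒢, Atheta T 𝒢 a' g ⬝ᵥ Y i g) := by
  have hmem : ∀ d ∈ assigns N 𝒢 Ng, ∀ g : 𝒢, ∑ i, ind d i g = (Ng g : ℝ) := by
    intro d hd g
    simp only [assigns, Finset.mem_filter, Finset.mem_univ, true_and] at hd
    rw [← hd g g.2, Finset.card_filter]
    push_cast
    refine Finset.sum_congr rfl fun i _ => ?_
    simp only [ind, Subtype.ext_iff]
  have hperm : ∀ d ∈ assigns N 𝒢 Ng, ∀ σ : Equiv.Perm (Fin N), d ∘ σ ∈ assigns N 𝒢 Ng := by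
    intro d hd σ
    simp only [assigns, Finset.mem_filter, Finset.mem_univ, true_and] at hd ⊢
    intro g hg
    rw [← hd g hg]
    refine Finset.card_bij (fun i _ => σ i) ?_ ?_ ?_
    · intro i hi; simpa using hi
    · intro i _ j _ h; exact σ.injective h
    · intro i hi; exact ⟨σ.symm i, by simpa using hi, by simp⟩
  have h0 : ∀ g : 𝒢, (Ng g : ℝ) ≠ 0 := by
    intro g
    have := hNg g g.2
    positivity
  have := lin_cov (assigns N 𝒢 Ng) (fun g : 𝒢 => (Ng g : ℝ)) hN hperm
    (assigns_nonempty N 𝒢 Ng hsum) hmem h0 (fun i g => Atheta T 𝒢 a g ⬝ᵥ Y i g)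
    (fun i g => Atheta T 𝒢 a' g ⬝ᵥ Y i g)
  simp only [covE, expec, thetaHat0_eq_lin]
  rw [this, ← Finset.sum_coe_sort 𝒢]
  congr 1
  · refine Finset.sum_congr rfl fun g _ => ?_
    rw [pc_dot]; rfl
  · simp only [← Finset.sum_coe_sort 𝒢]

lemma pre_zero {N T : ℕ} (𝒢 : Finset Date) (Y : Fin N → Date → Fin T → ℝ)
    (b : Fin T → Date → Date → ℝ)
    (hNA : ∀ (i : Fin N) (t : Fin T), ∀ g ∈ 𝒢, ∀ g' ∈ 𝒢,
      periodLT t g → periodLT t g' → Y i g t = Y i g' t)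
    (hb : ∀ (t : Fin T) (g g' : Date),
      b t g g' ≠ 0 → periodLT t g ∧ periodLT t g') (i : Fin N) :
    ∑ g ∈ 𝒢, Atheta T 𝒢 b g ⬝ᵥ Y i g = 0 := by
  rw [← contrast_eq 𝒢 b (Y i)]
  refine Finset.sum_eq_zero fun t _ => Finset.sum_eq_zero fun g hg =>
    Finset.sum_eq_zero fun g' hg' => ?_
  by_cases h : b t g g' = 0
  · simp [h]
  · obtain ⟨h1, h2⟩ := hb t g g' h
    rw [hNA i t g hg g' hg' h1 h2]; simp

lemma pc_zero {N : ℕ} (y : Fin N → ℝ) : pc (fun _ => (0 : ℝ)) y = 0 := by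
  simp [pc, popMeanS]



/-- **Proposition 1, explicit variance formulas.** Under Assumptions 1 and 2:
`Var(θ̂₀) = Σ_g N_g⁻¹ A_{θ,g} S_g A_{θ,g}' - N⁻¹ S_θ`,
`Cov(X̂, θ̂₀) = Σ_g N_g⁻¹ A_{0,g} S_g A_{θ,g}'`, and
`Var(X̂) = Σ_g N_g⁻¹ A_{0,g} S_g A_{0,g}'`. -/
theorem statement6
    (N T M : ℕ) (𝒢 : Finset Date) (Ng : Date → ℕ) (Y : Fin N → Date → Fin T → ℝ)
    (a : Fin T → Date → Date → ℝ) (b : Fin M → Fin T → Date → Date → ℝ)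
    (hN : 2 ≤ N) (h𝒢ne : 𝒢.Nonempty)
    (h𝒢 : ∀ g ∈ 𝒢, (1 ≤ g ∧ g ≤ (T : Date)) ∨ g = ⊤)
    (hNg : ∀ g ∈ 𝒢, 1 ≤ Ng g) (hsum : ∑ g ∈ 𝒢, Ng g = N)
    (hNA : ∀ (i : Fin N) (t : Fin T), ∀ g ∈ 𝒢, ∀ g' ∈ 𝒢,
      periodLT t g → periodLT t g' → Y i g t = Y i g' t)
    (hb : ∀ (j : Fin M) (t : Fin T) (g g' : Date),
      b j t g g' ≠ 0 → periodLT t g ∧ periodLT t g') :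
    (varE N 𝒢 Ng (fun d => thetaHat0 𝒢 Ng a (obs Y d) d) =
      (∑ g ∈ 𝒢, ((Ng g : ℝ))⁻¹ *
        (Atheta T 𝒢 a g ⬝ᵥ (Sg N T Y g).mulVec (Atheta T 𝒢 a g))) -
        ((N : ℝ))⁻¹ * Stheta N T 𝒢 Y a) ∧
    (∀ j : Fin M,
      covE N 𝒢 Ng (fun d => Xhat 𝒢 Ng b (obs Y d) d j)
          (fun d => thetaHat0 𝒢 Ng a (obs Y d) d) =
        (∑ g ∈ 𝒢, ((Ng g : ℝ))⁻¹ •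
          ((A0 T M 𝒢 b g * Sg N T Y g).mulVec (Atheta T 𝒢 a g))) j) ∧
    (∀ j k : Fin M,
      covE N 𝒢 Ng (fun d => Xhat 𝒢 Ng b (obs Y d) d j)
          (fun d => Xhat 𝒢 Ng b (obs Y d) d k) =
        (∑ g ∈ 𝒢, ((Ng g : ℝ))⁻¹ • (A0 T M 𝒢 b g * Sg N T Y g * (A0 T M 𝒢 b g)ᵀ)) j k) := by
  refine ⟨?_, ?_, ?_⟩
  · have := cov_theta 𝒢 Ng Y a a hN hNg hsum
    simp only [covE, ← pow_two] at this
    simp only [varE, Stheta, popVarS, pow_two] at this ⊢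
    exact this
  · intro j
    have := cov_theta 𝒢 Ng Y (b j) a hN hNg hsum
    simp only [pre_zero 𝒢 Y (b j) hNA (hb j), pc_zero, mul_zero, sub_zero] at this
    refine Eq.trans this ?_
    rw [Finset.sum_apply]
    refine Finset.sum_congr rfl fun g _ => ?_
    rw [← Matrix.mulVec_mulVec]
    rfl
  · intro j k
    have := cov_theta 𝒢 Ng Y (b j) (b k) hN hNg hsum
    simp only [pre_zero 𝒢 Y (b j) hNA (hb j), pc_zero, mul_zero, sub_zero] at this
    refine Eq.trans this ?_
    rw [Matrix.sum_apply]
    refine Finset.sum_congr rfl fun g _ => ?_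
    rw [Matrix.mul_assoc]
    rfl

end Staggered
end
end

section
/- (Lemma A3, decomposition of treatment-effect heterogeneity.) Suppose Assumptions 1 and 2 hold and there exists g_min ∈ 𝒢 ∩ {2,…,T} such that A_{θ,g} = 0 for every g ∈ 𝒢 with g < g_min. Let M be the (g_min − 1) × T matrix selecting the coordinates t < g_min (so M Y_i(g) ∈ ℝ^{g_min−1} is the vector of pre-g_min outcomes), and suppose M S_{g_min} M′ is invertible. Then: (i) under Assumption 2, M S_g M′ = M S_{g_min} M′ for every g ∈ 𝒢 with g ≥ g_min; (ii) setting β_g := (M S_g M′)^{-1} M S_g A_{θ,g}′ for g ≥ g_min and θ̃_i := Σ_{g≥g_min} A_{θ,g} Y_i(g) − Σ_{g≥g_min} (M Y_i(g))′ β_g, one has S_θ = S(θ̃) + (Σ_{g≥g_min} β_g)′ (M S_{g_min} M′) (Σ_{g≥g_min} β_g), where S_θ := S(Σ_{g∈𝒢} A_{θ,g} Y(g)); in particular 0 ≤ S(θ̃) ≤ S_θ. -/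
open Finset Filter Topology Matrix MeasureTheory ProbabilityTheory
open scoped BigOperators Classical ENNReal NNReal

noncomputable section

namespace Staggered

/-- Finite-population covariance of two scalar attributes. -/
def scov (N : ℕ) (u v : Fin N → ℝ) : ℝ :=
  (∑ i, (u i - popMeanS N u) * (v i - popMeanS N v)) / ((N : ℝ) - 1)

lemma popVarS_eq (N : ℕ) (w : Fin N → ℝ) : popVarS N w = scov N w w := by
  simp [popVarS, scov, pow_two]

lemma scov_comm (N : ℕ) (u v : Fin N → ℝ) : scov N u v = scov N v u := by
  simp [scov, mul_comm]

lemma popMeanS_add (N : ℕ) (u v : Fin N → ℝ) :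
    popMeanS N (u + v) = popMeanS N u + popMeanS N v := by
  simp [popMeanS, Finset.sum_add_distrib, add_div]

lemma scov_add_left (N : ℕ) (u u' v : Fin N → ℝ) :
    scov N (u + u') v = scov N u v + scov N u' v := by
  simp only [scov, popMeanS_add, Pi.add_apply]
  rw [← add_div, ← Finset.sum_add_distrib]
  congr 1
  apply Finset.sum_congr rfl
  intros
  ring

lemma scov_add_right (N : ℕ) (u v v' : Fin N → ℝ) :
    scov N u (v + v') = scov N u v + scov N u v' := by
  rw [scov_comm, scov_add_left, scov_comm N v, scov_comm N v']

lemma scov_zero_right (N : ℕ) (u : Fin N → ℝ) : scov N u 0 = 0 := by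
  simp [scov, popMeanS]

lemma scov_sum_right {ι : Type*} (N : ℕ) (u : Fin N → ℝ) (s : Finset ι)
    (f : ι → Fin N → ℝ) :
    scov N u (∑ g ∈ s, f g) = ∑ g ∈ s, scov N u (f g) := by
  induction s using Finset.induction_on with
  | empty => simp [scov_zero_right]
  | insert a s ha ih => rw [Finset.sum_insert ha, Finset.sum_insert ha, scov_add_right, ih]

lemma popVarS_nonneg (N : ℕ) (hN : 2 ≤ N) (w : Fin N → ℝ) : 0 ≤ popVarS N w := by
  have : (2 : ℝ) ≤ N := by exact_mod_cast hN
  exact div_nonneg (Finset.sum_nonneg fun i _ => sq_nonneg _) (by linarith)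

lemma popMeanS_dot (N K : ℕ) (W : Fin N → Fin K → ℝ) (p : Fin K → ℝ) :
    popMeanS N (fun i => p ⬝ᵥ W i) = p ⬝ᵥ popMeanV N K W := by
  simp only [popMeanS, popMeanV, dotProduct]
  rw [Finset.sum_comm, Finset.sum_div]
  apply Finset.sum_congr rfl
  intro k _
  rw [← Finset.mul_sum, mul_div_assoc]

lemma dot_popCov (N K : ℕ) (W : Fin N → Fin K → ℝ) (p q : Fin K → ℝ) :
    p ⬝ᵥ (popCov N K W).mulVec q = scov N (fun i => p ⬝ᵥ W i) (fun i => q ⬝ᵥ W i) := by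
  simp only [scov, popMeanS_dot, ← dotProduct_sub]
  simp only [popCov, mulVec, dotProduct, Matrix.of_apply, Pi.sub_apply, Finset.sum_div,
    Finset.sum_mul, Finset.mul_sum]
  conv_lhs =>
    enter [2, k]
    rw [Finset.sum_comm]
  rw [Finset.sum_comm]
  apply Finset.sum_congr rfl
  intro i _
  rw [Finset.sum_comm]
  apply Finset.sum_congr rfl
  intro l _
  apply Finset.sum_congr rfl
  intro k _
  ring

lemma dot_MS (N T L : ℕ) (M : Matrix (Fin L) (Fin T) ℝ) (Y : Fin N → Date → Fin T → ℝ)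
    (g : Date) (p : Fin L → ℝ) (q : Fin T → ℝ) :
    p ⬝ᵥ (M * Sg N T Y g).mulVec q
      = scov N (fun i => M.mulVec (Y i g) ⬝ᵥ p) (fun i => q ⬝ᵥ Y i g) := by
  have h := dot_popCov N T (fun i => Y i g) (p ᵥ* M) q
  rw [← mulVec_mulVec, dotProduct_mulVec]
  refine h.trans ?_
  simp only [← dotProduct_mulVec]
  simp only [dotProduct_comm p]

lemma dot_MSM (N T L : ℕ) (M : Matrix (Fin L) (Fin T) ℝ) (Y : Fin N → Date → Fin T → ℝ)
    (g : Date) (p q : Fin L → ℝ) :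
    p ⬝ᵥ (M * Sg N T Y g * Mᵀ).mulVec q
      = scov N (fun i => M.mulVec (Y i g) ⬝ᵥ p) (fun i => M.mulVec (Y i g) ⬝ᵥ q) := by
  rw [← mulVec_mulVec, dot_MS]
  congr 1
  funext i
  rw [mulVec_transpose, ← dotProduct_mulVec, dotProduct_comm]

/-- **Lemma A3, decomposition of treatment-effect heterogeneity.**
If `A_{θ,g} = 0` for `g < g_min` and `M` selects the pre-`g_min` periods then, under
no anticipation, (i) `M S_g M' = M S_{g_min} M'` for all `g ≥ g_min`, and (ii) with
`β_g = (M S_g M')⁻¹ M S_g A_{θ,g}'` and `θ̃_i = Σ_{g≥g_min} A_{θ,g} Y_i(g) -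
Σ_{g≥g_min} (M Y_i(g))'β_g`, one has
`S_θ = S(θ̃) + (Σβ_g)'(M S_{g_min} M')(Σβ_g)`; in particular `0 ≤ S(θ̃) ≤ S_θ`. -/
theorem statement8
    (N T : ℕ) (𝒢 : Finset Date) (Ng : Date → ℕ) (Y : Fin N → Date → Fin T → ℝ)
    (a : Fin T → Date → Date → ℝ) (gmin : ℕ)
    (hN : 2 ≤ N) (h𝒢ne : 𝒢.Nonempty)
    (h𝒢 : ∀ g ∈ 𝒢, (1 ≤ g ∧ g ≤ (T : Date)) ∨ g = ⊤)
    (hNg : ∀ g ∈ 𝒢, 1 ≤ Ng g) (hsum : ∑ g ∈ 𝒢, Ng g = N)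
    (hNA : ∀ (i : Fin N) (t : Fin T), ∀ g ∈ 𝒢, ∀ g' ∈ 𝒢,
      periodLT t g → periodLT t g' → Y i g t = Y i g' t)
    (hgmem : (gmin : Date) ∈ 𝒢) (hg2 : 2 ≤ gmin) (hgT : gmin ≤ T)
    (hAzero : ∀ g ∈ 𝒢, g < (gmin : Date) → Atheta T 𝒢 a g = 0)
    (hMInv : IsUnit (Msel T gmin * Sg N T Y (gmin : Date) * (Msel T gmin)ᵀ)) :
    (∀ g ∈ 𝒢, (gmin : Date) ≤ g →
      Msel T gmin * Sg N T Y g * (Msel T gmin)ᵀ =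
        Msel T gmin * Sg N T Y (gmin : Date) * (Msel T gmin)ᵀ) ∧
    (let βg : Date → Fin (gmin - 1) → ℝ := fun g =>
        (Msel T gmin * Sg N T Y g * (Msel T gmin)ᵀ)⁻¹.mulVec
          ((Msel T gmin * Sg N T Y g).mulVec (Atheta T 𝒢 a g))
     let thetaTilde : Fin N → ℝ := fun i =>
        (∑ g ∈ 𝒢.filter fun g => (gmin : Date) ≤ g, Atheta T 𝒢 a g ⬝ᵥ Y i g) -
          ∑ g ∈ 𝒢.filter fun g => (gmin : Date) ≤ g, (Msel T gmin).mulVec (Y i g) ⬝ᵥ βg g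
     Stheta N T 𝒢 Y a = popVarS N thetaTilde +
        (∑ g ∈ 𝒢.filter fun g => (gmin : Date) ≤ g, βg g) ⬝ᵥ
          ((Msel T gmin * Sg N T Y (gmin : Date) * (Msel T gmin)ᵀ).mulVec
            (∑ g ∈ 𝒢.filter fun g => (gmin : Date) ≤ g, βg g)) ∧
      0 ≤ popVarS N thetaTilde ∧ popVarS N thetaTilde ≤ Stheta N T 𝒢 Y a) := by
  have hX : ∀ g ∈ 𝒢, (gmin : Date) ≤ g → ∀ i,
      (Msel T gmin).mulVec (Y i g) = (Msel T gmin).mulVec (Y i gmin) := by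
    intro g hg hle i
    funext k
    simp only [mulVec, dotProduct]
    apply Finset.sum_congr rfl
    intro t _
    simp only [Msel, Matrix.of_apply]
    split_ifs with h
    · have hlt : periodLT t (gmin : Date) := by
        unfold periodLT
        have := k.2
        exact_mod_cast (by omega : (t : ℕ) + 1 < gmin)
      rw [hNA i t g hg gmin hgmem (lt_of_lt_of_le hlt hle) hlt]
    · simp
  have h1 : ∀ g ∈ 𝒢, (gmin : Date) ≤ g →
      Msel T gmin * Sg N T Y g * (Msel T gmin)ᵀ =
        Msel T gmin * Sg N T Y (gmin : Date) * (Msel T gmin)ᵀ := by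
    intro g hg hle
    have key : ∀ p q, p ⬝ᵥ (Msel T gmin * Sg N T Y g * (Msel T gmin)ᵀ).mulVec q =
        p ⬝ᵥ (Msel T gmin * Sg N T Y (gmin : Date) * (Msel T gmin)ᵀ).mulVec q := by
      intro p q
      rw [dot_MSM, dot_MSM]
      simp only [hX g hg hle]
    ext k l
    have := key (Pi.single k 1) (Pi.single l 1)
    simpa using this
  refine ⟨h1, ?_⟩
  intro βg thetaTilde
  set Q := Msel T gmin * Sg N T Y (gmin : Date) * (Msel T gmin)ᵀ with hQ
  set F := 𝒢.filter fun g => (gmin : Date) ≤ g with hF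
  set β := ∑ g ∈ F, βg g with hβ
  have hdet : IsUnit Q.det := (Matrix.isUnit_iff_isUnit_det _).1 hMInv
  have hβg : ∀ g ∈ F, Q.mulVec (βg g) = (Msel T gmin * Sg N T Y g).mulVec (Atheta T 𝒢 a g) := by
    intro g hg
    obtain ⟨hg1, hg2⟩ := Finset.mem_filter.1 hg
    simp only [βg]
    rw [h1 g hg1 hg2, mulVec_mulVec, Matrix.mul_nonsing_inv _ hdet, one_mulVec]
  let xb : Fin N → ℝ := fun i => (Msel T gmin).mulVec (Y i gmin) ⬝ᵥ β
  let w : Fin N → ℝ := ∑ g ∈ F, fun i => Atheta T 𝒢 a g ⬝ᵥ Y i g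
  have hth : w = thetaTilde + xb := by
    funext i
    have : ∑ g ∈ F, (Msel T gmin).mulVec (Y i g) ⬝ᵥ βg g = xb i := by
      simp only [xb, hβ, dotProduct_sum]
      apply Finset.sum_congr rfl
      intro g hg
      obtain ⟨hg1, hg2⟩ := Finset.mem_filter.1 hg
      rw [hX g hg1 hg2]
    simp only [w, thetaTilde, Pi.add_apply, Finset.sum_apply, ← hF, this]
    ring
  have hS : Stheta N T 𝒢 Y a = popVarS N w := by
    unfold Stheta
    congr 1
    funext i
    simp only [w, Finset.sum_apply]
    symm
    apply Finset.sum_subset (Finset.filter_subset _ _)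
    intro g hg hgF
    have : g < (gmin : Date) := by
      by_contra hc
      exact hgF (Finset.mem_filter.2 ⟨hg, not_lt.1 hc⟩)
    rw [hAzero g hg this, zero_dotProduct]
  have hq : β ⬝ᵥ Q.mulVec β = scov N xb xb := dot_MSM N T _ _ Y _ β β
  have hc : scov N xb w = β ⬝ᵥ Q.mulVec β := by
    have e : Q.mulVec β = ∑ g ∈ F, Q.mulVec (βg g) := by
      rw [hβ, Matrix.mulVec_sum]
    rw [e, dotProduct_sum]
    simp only [w]
    rw [scov_sum_right]
    apply Finset.sum_congr rfl
    intro g hg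
    obtain ⟨hg1, hg2⟩ := Finset.mem_filter.1 hg
    rw [hβg g hg, dot_MS]
    simp only [xb, hX g hg1 hg2]
  have horth : scov N xb thetaTilde = 0 := by
    rw [hth, scov_add_right, hq] at hc
    linarith
  have hmain : Stheta N T 𝒢 Y a = popVarS N thetaTilde + β ⬝ᵥ Q.mulVec β := by
    rw [hS, hq, popVarS_eq, popVarS_eq, hth, scov_add_left, scov_add_right, scov_add_right,
      scov_comm N thetaTilde xb, horth]
    ring
  refine ⟨hmain, popVarS_nonneg N hN _, ?_⟩
  have := popVarS_nonneg N hN xb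
  rw [popVarS_eq, ← hq] at this
  linarith

end Staggered
end
end
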